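/- arXiv:2405.19361 — 5 statements merged into one kernel-verified Lean document; each statement's English description precedes it below -/
import Mathlib

section
/- Let x, y be real numbers with 0 < 2x < y. If moreover 2x > 2(2 + 1/ln 2) (equivalently x > 2 + 1/ln 2), then F(x,y) > 0. -/
noncomputable def F (x y : ℝ) : ℝ :=
  2 * (1 / x - 1 / (y - x)) + (1 / 2) * ((2:ℝ) ^ (y - x) / (y - x) - (2:ℝ) ^ x / x)
    - ((2:ℝ) ^ (y - x) - (2:ℝ) ^ x) / ((y - x) * x)

theorem F_pos_of_large (x y : ℝ) (h1 : 0 < 2 * x) (h2 : 2 * x < y)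
    (h3 : 2 * (2 + 1 / Real.log 2) < 2 * x) : 0 < F x y := by
  have hL : 0 < Real.log 2 := Real.log_pos one_lt_two
  have hx : 0 < x := by linarith
  have hd : 0 < y - x - x := by linarith
  have hz : 0 < y - x := by linarith
  have hslope : 1 < Real.log 2 * (x - 2) := by
    have h : 1 / Real.log 2 < x - 2 := by linarith
    rwa [div_lt_iff₀' hL] at h
  have hx2 : 0 < x - 2 := by
    have h : 0 < 1 / Real.log 2 := by positivity
    linarith
  have hpow : (2:ℝ) ^ (y - x) = (2:ℝ) ^ x * (2:ℝ) ^ (y - x - x) := by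
    rw [← Real.rpow_add two_pos]
    congr 1
    ring
  have hexp : 1 + Real.log 2 * (y - x - x) ≤ (2:ℝ) ^ (y - x - x) := by
    rw [Real.rpow_def_of_pos two_pos]
    linarith [Real.add_one_le_exp (Real.log 2 * (y - x - x))]
  have hF : F x y = (2 * (y - x - x) +
      (2:ℝ) ^ x * ((2:ℝ) ^ (y - x - x) * (x - 2) - (y - x - 2)) / 2) / ((y - x) * x) := by
    rw [F, hpow]
    field_simp
    ring
  have hbracket : 0 ≤ (2:ℝ) ^ (y - x - x) * (x - 2) - (y - x - 2) := by
    linarith [mul_le_mul_of_nonneg_right hexp hx2.le, mul_pos hd (sub_pos.2 hslope)]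
  rw [hF]
  positivity
end

section
/- For all integers k and m with 6 ≤ 2m < k, one has F(m,k) > 0. -/
theorem F_eq_div {x y : ℝ} (hx : x ≠ 0) (hyx : y - x ≠ 0) :
    F x y = (2 * (y - 2 * x) + (2:ℝ) ^ (y - x) * (x - 2) / 2
      - (2:ℝ) ^ x * (y - x - 2) / 2) / ((y - x) * x) := by
  unfold F
  field_simp
  ring

theorem F_pos_int (k m : ℤ) (h1 : 6 ≤ 2 * m) (h2 : 2 * m < k) :
    0 < F (m : ℝ) (k : ℝ) := by
  obtain ⟨d, hd⟩ := Int.eq_ofNat_of_zero_le (show 0 ≤ k - 2 * m by lia)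
  obtain rfl : k = 2 * m + d := by lia
  have hm : (3:ℝ) ≤ m := by exact_mod_cast (show 3 ≤ m by lia)
  have hd1 : (1:ℝ) ≤ d := by exact_mod_cast (show 1 ≤ d by lia)
  have hsub : ((2 * m + d : ℤ) : ℝ) - m = m + d := by push_cast; ring
  rw [F_eq_div (by linarith) (by rw [hsub]; linarith), hsub,
    Real.rpow_add_natCast two_ne_zero]
  have hpow : (0:ℝ) < 2 ^ (m:ℝ) := by positivity
  have hbern : (d:ℝ) + 1 ≤ 2 ^ d := by exact_mod_cast d.lt_two_pow_self
  have hbracket : 0 ≤ (2:ℝ) ^ d * (m - 2) - (m + d - 2) := by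
    nlinarith [mul_le_mul_of_nonneg_right hbern (show (0:ℝ) ≤ m - 2 by linarith),
      mul_nonneg (show (0:ℝ) ≤ d by linarith) (show (0:ℝ) ≤ m - 3 by linarith)]
  apply div_pos _ (by nlinarith)
  push_cast
  linarith [mul_nonneg hpow.le hbracket]
end

section
/- For any fixed s ∈ (0,1), the function t ↦ h(st)/h(t)^s is strictly increasing in t on (0,∞). -/
noncomputable def h (t : ℝ) : ℝ :=
  if t = 0 then 1 / 2 else Real.exp t * (Real.exp t - 1 - t) / (Real.exp t - 1) ^ 2

open Real Set in
theorem pos_of_hasDerivAt_pos {f f' : ℝ → ℝ} (hf : ∀ x, HasDerivAt f (f' x) x) (h0 : f 0 = 0)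
    (hpos : ∀ x, 0 < x → 0 < f' x) (x : ℝ) (hx : 0 < x) : 0 < f x := by
  have hmono : StrictMonoOn f (Ici 0) := by
    refine strictMonoOn_of_deriv_pos (convex_Ici 0)
      (fun y _ => (hf y).continuousAt.continuousWithinAt) fun y hy => ?_
    rw [interior_Ici] at hy
    rw [(hf y).deriv]
    exact hpos y hy
  simpa [h0] using hmono self_mem_Ici hx.le hx

theorem hasDerivAt_exp_mul (k x : ℝ) :
    HasDerivAt (fun t => Real.exp (k * t)) (k * Real.exp (k * x)) x := by
  simpa [mul_comm] using ((hasDerivAt_id x).const_mul k).exp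

/-- Differentiation of the exponential polynomials in `exp_poly_pos`. -/
theorem hasDerivAt_exp_poly (a b c d p q r k x : ℝ) :
    HasDerivAt
      (fun t => (a * t + b) * Real.exp (3 * t) + (c * t + d) * Real.exp (2 * t)
        + (p * t ^ 2 + q * t + r) * Real.exp (1 * t) + k)
      ((3 * a * x + (3 * b + a)) * Real.exp (3 * x) + (2 * c * x + (2 * d + c)) * Real.exp (2 * x)
        + (p * x ^ 2 + (q + 2 * p) * x + (r + q)) * Real.exp (1 * x)) x := by
  have hlin (a b : ℝ) : HasDerivAt (fun t => a * t + b) a x := by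
    simpa using ((hasDerivAt_id x).const_mul a).add_const b
  have hquad : HasDerivAt (fun t => p * t ^ 2 + q * t + r) (2 * p * x + q) x := by
    refine ((((hasDerivAt_pow 2 x).const_mul p).add
      ((hasDerivAt_id x).const_mul q)).add_const r).congr_deriv ?_
    simp
    ring
  refine (((((hlin a b).mul (hasDerivAt_exp_mul 3 x)).add
    ((hlin c d).mul (hasDerivAt_exp_mul 2 x))).add
    (hquad.mul (hasDerivAt_exp_mul 1 x))).add_const k).congr_deriv ?_
  ring

theorem hasDerivAt_exp_poly_two (a b c d p q r x : ℝ) :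
    HasDerivAt
      (fun t => (a * t + b) * Real.exp (2 * t) + (c * t + d) * Real.exp (1 * t)
        + (p * t ^ 2 + q * t + r))
      ((2 * a * x + (2 * b + a)) * Real.exp (2 * x) + (c * x + (d + c)) * Real.exp (1 * x)
        + (2 * p * x + q)) x := by
  have hlin (a b : ℝ) : HasDerivAt (fun t => a * t + b) a x := by
    simpa using ((hasDerivAt_id x).const_mul a).add_const b
  have hquad : HasDerivAt (fun t => p * t ^ 2 + q * t + r) (2 * p * x + q) x := by
    refine ((((hasDerivAt_pow 2 x).const_mul p).add
      ((hasDerivAt_id x).const_mul q)).add_const r).congr_deriv ?_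
    simp
    ring
  refine ((((hlin a b).mul (hasDerivAt_exp_mul 2 x)).add
    ((hlin c d).mul (hasDerivAt_exp_mul 1 x))).add hquad).congr_deriv ?_
  ring

theorem exp_poly_two_pos (x : ℝ) (hx : 0 < x) :
    0 < (3 * x + -8) * Real.exp (2 * x) + (4 * x + 16) * Real.exp (1 * x)
      + (-2 * x ^ 2 + -7 * x + -8) := by
  have h2 : ∀ x : ℝ, 0 < x →
      0 < (0 * x + 0) * Real.exp (2 * x) + (24 * x + -4) * Real.exp (1 * x)
        + (0 * x ^ 2 + 0 * x + 4) :=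
    pos_of_hasDerivAt_pos (hasDerivAt_exp_poly_two 0 0 24 (-4) 0 0 4) (by norm_num)
      fun y hy => by norm_num; positivity
  have h1 : ∀ x : ℝ, 0 < x →
      0 < (0 * x + 0) * Real.exp (2 * x) + (24 * x + -28) * Real.exp (1 * x)
        + (0 * x ^ 2 + 4 * x + 28) :=
    pos_of_hasDerivAt_pos (hasDerivAt_exp_poly_two 0 0 24 (-28) 0 4 28) (by norm_num)
      fun y hy => (h2 y hy).trans_eq (by ring)
  refine pos_of_hasDerivAt_pos (hasDerivAt_exp_poly_two 3 (-8) 4 16 (-2) (-7) (-8)) (by norm_num)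
    (fun y hy => ?_) x hx
  have h3 : ∀ x : ℝ, 0 < x →
      0 < (12 * x + -20) * Real.exp (2 * x) + (4 * x + 24) * Real.exp (1 * x)
        + (0 * x ^ 2 + 0 * x + -4) :=
    pos_of_hasDerivAt_pos (hasDerivAt_exp_poly_two 12 (-20) 4 24 0 0 (-4)) (by norm_num)
      fun y hy => by
        have := mul_pos (Real.exp_pos y) (h1 y hy)
        refine this.trans_eq ?_
        rw [two_mul y, Real.exp_add, one_mul]
        ring
  have h4 := pos_of_hasDerivAt_pos (hasDerivAt_exp_poly_two 6 (-13) 4 20 0 (-4) (-7)) (by norm_num)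
    (fun y hy => (h3 y hy).trans_eq (by ring)) y hy
  refine h4.trans_eq ?_
  ring

theorem exp_poly_pos (x : ℝ) (hx : 0 < x) :
    2 * Real.exp x * (Real.exp x - 1 - x) ^ 2
      < (x * Real.exp x - Real.exp x + 1) * (Real.exp x - 1) ^ 2 := by
  have key := pos_of_hasDerivAt_pos (hasDerivAt_exp_poly 1 (-3) 2 7 (-2) (-3) (-5) 1) (by norm_num)
    (fun y hy => by
      have := mul_pos (Real.exp_pos y) (exp_poly_two_pos y hy)
      refine this.trans_eq ?_
      have e2 : Real.exp (2 * y) = Real.exp y ^ 2 := by simpa using Real.exp_nat_mul y 2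
      have e3 : Real.exp (3 * y) = Real.exp y ^ 3 := by simpa using Real.exp_nat_mul y 3
      simp only [e2, e3, one_mul]
      ring) x hx
  rw [show 3 * x = x + x + x by ring, two_mul x, Real.exp_add, Real.exp_add, one_mul] at key
  linear_combination key

theorem exp_sub_one_pos {t : ℝ} (ht : 0 < t) : 0 < Real.exp t - 1 := by
  linarith [Real.add_one_lt_exp ht.ne']

theorem exp_sub_one_sub_self_pos {t : ℝ} (ht : 0 < t) : 0 < Real.exp t - 1 - t := by
  linarith [Real.add_one_lt_exp ht.ne']

theorem h_pos {t : ℝ} (ht : 0 < t) : 0 < h t := by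
  rw [h, if_neg ht.ne']
  have h1 := exp_sub_one_pos ht
  have h2 := exp_sub_one_sub_self_pos ht
  positivity

theorem log_h {t : ℝ} (ht : 0 < t) :
    Real.log (h t) = t + Real.log (Real.exp t - 1 - t) - 2 * Real.log (Real.exp t - 1) := by
  have h1 := exp_sub_one_pos ht
  have h2 := exp_sub_one_sub_self_pos ht
  rw [h, if_neg ht.ne', Real.log_div (by positivity) (by positivity),
    Real.log_mul (by positivity) h2.ne', Real.log_exp, Real.log_pow]
  norm_num

theorem hasDerivAt_log_h {t : ℝ} (ht : 0 < t) :
    HasDerivAt (fun x => Real.log (h x))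
      (1 + (Real.exp t - 1) / (Real.exp t - 1 - t) - 2 * (Real.exp t / (Real.exp t - 1))) t := by
  have h1 := exp_sub_one_pos ht
  have h2 := exp_sub_one_sub_self_pos ht
  have e1 := (Real.hasDerivAt_exp t).sub_const 1
  have hd := ((hasDerivAt_id t).add ((e1.sub (hasDerivAt_id t)).log h2.ne')).sub
    ((e1.log h1.ne').const_mul 2)
  refine hd.congr_of_eventuallyEq ?_
  filter_upwards [lt_mem_nhds ht] with x hx
  exact log_h hx

theorem logDeriv_h_strictAntiOn :
    StrictAntiOn (fun t : ℝ => 1 + (Real.exp t - 1) / (Real.exp t - 1 - t)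
      - 2 * (Real.exp t / (Real.exp t - 1))) (Set.Ioi 0) := by
  have hd : ∀ t ∈ Set.Ioi (0 : ℝ), HasDerivAt (fun t : ℝ => 1 +
      (Real.exp t - 1) / (Real.exp t - 1 - t) - 2 * (Real.exp t / (Real.exp t - 1)))
      ((2 * Real.exp t * (Real.exp t - 1 - t) ^ 2
        - (t * Real.exp t - Real.exp t + 1) * (Real.exp t - 1) ^ 2)
        / ((Real.exp t - 1 - t) ^ 2 * (Real.exp t - 1) ^ 2)) t := by
    intro t ht
    have h1 := exp_sub_one_pos ht
    have h2 := exp_sub_one_sub_self_pos ht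
    have e0 := Real.hasDerivAt_exp t
    have e1 := e0.sub_const 1
    have e2 := e1.sub (hasDerivAt_id t)
    refine (((e1.div e2 h2.ne').const_add 1).sub
      ((e0.div e1 h1.ne').const_mul 2)).congr_deriv ?_
    simp only [Pi.sub_apply, id]
    field_simp
    ring
  refine strictAntiOn_of_deriv_neg (convex_Ioi 0)
    (fun t ht => (hd t ht).continuousAt.continuousWithinAt) fun t ht => ?_
  rw [interior_Ioi] at ht
  rw [(hd t ht).deriv]
  have h1 := exp_sub_one_pos ht
  have h2 := exp_sub_one_sub_self_pos ht
  exact div_neg_of_neg_of_pos (sub_neg.2 (exp_poly_pos t ht)) (by positivity)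

theorem h_ratio_strictMono (s : ℝ) (hs : s ∈ Set.Ioo (0:ℝ) 1) :
    StrictMonoOn (fun t : ℝ => h (s * t) / (h t) ^ s) (Set.Ioi 0) := by
  obtain ⟨hs0, hs1⟩ := hs
  have hmono : StrictMonoOn (fun t => Real.log (h (s * t)) - s * Real.log (h t)) (Set.Ioi 0) := by
    have hd (t : ℝ) (ht : 0 < t) :=
      ((hasDerivAt_log_h (mul_pos hs0 ht)).comp t ((hasDerivAt_id t).const_mul s)).sub
        ((hasDerivAt_log_h ht).const_mul s)
    refine strictMonoOn_of_deriv_pos (convex_Ioi 0)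
      (fun t ht => (hd t ht).continuousAt.continuousWithinAt) fun t ht => ?_
    rw [interior_Ioi] at ht
    have hst : s * t < t := mul_lt_of_lt_one_left ht hs1
    have hlt := logDeriv_h_strictAntiOn (Set.mem_Ioi.2 (mul_pos hs0 ht)) ht hst
    refine lt_of_lt_of_eq (mul_pos hs0 (sub_pos.2 hlt)) (Eq.trans ?_ (hd t ht).deriv.symm)
    ring
  refine (Real.exp_strictMono.comp_strictMonoOn hmono).congr fun t ht => ?_
  have hp := h_pos ht
  simp only [Function.comp_apply]
  rw [Real.exp_sub, Real.exp_log (h_pos (mul_pos hs0 ht)), Real.rpow_def_of_pos hp, mul_comm (Real.log _)]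
end

section
/- For every x > 0, one has Φ(x) = ∫_0^∞ h(t) e^{−xt} dt. -/
open MeasureTheory

/-- `Φ x = x * ψ'(x) - 1`, where `ψ'` is the trigamma function, i.e. the second
derivative of the logarithm of the gamma function. -/
noncomputable def Phi (x : ℝ) : ℝ :=
  x * iteratedDeriv 2 (fun y => Real.log (Real.Gamma y)) x - 1

section DigammaSeries

open Real Set Filter Topology Finset

lemma differentiableAt_log_Gamma {x : ℝ} (hx : 0 < x) :
    DifferentiableAt ℝ (fun y => log (Gamma y)) x :=
  (differentiableAt_Gamma fun m => by
    have : (0 : ℝ) ≤ m := m.cast_nonneg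
    linarith).log (Gamma_pos_of_pos hx).ne'

lemma log_Gamma_add_one {x : ℝ} (hx : 0 < x) :
    log (Gamma (x + 1)) = log (Gamma x) + log x := by
  rw [Gamma_add_one hx.ne', log_mul hx.ne' (Gamma_pos_of_pos hx).ne', add_comm]

lemma deriv_log_Gamma_add_one {x : ℝ} (hx : 0 < x) :
    deriv (fun y => log (Gamma y)) (x + 1) = deriv (fun y => log (Gamma y)) x + 1 / x := by
  rw [← deriv_comp_add_const, one_div, ← deriv_log,
    ← deriv_add (differentiableAt_log_Gamma hx) (differentiableAt_log hx.ne')]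
  apply EventuallyEq.deriv_eq
  filter_upwards [eventually_gt_nhds hx] with y hy using log_Gamma_add_one hy

lemma deriv_log_Gamma_add_natCast {x : ℝ} (hx : 0 < x) (n : ℕ) :
    deriv (fun y => log (Gamma y)) (x + n) =
      deriv (fun y => log (Gamma y)) x + ∑ i ∈ Finset.range n, 1 / (x + i) := by
  induction n with
  | zero => simp
  | succ n ih =>
    rw [Finset.sum_range_succ, Nat.cast_succ, ← add_assoc,
      deriv_log_Gamma_add_one (by positivity), ih, add_assoc]

lemma deriv_log_Gamma_le_log {x : ℝ} (hx : 0 < x) :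
    deriv (fun y => log (Gamma y)) x ≤ log x := by
  refine (ConvexOn.deriv_le_slope convexOn_log_Gamma hx (by positivity : 0 < x + 1)
    (by linarith) (differentiableAt_log_Gamma hx)).trans_eq ?_
  rw [slope_def_field]
  simp [log_Gamma_add_one hx]

lemma log_le_deriv_log_Gamma_add_one {x : ℝ} (hx : 0 < x) :
    log x ≤ deriv (fun y => log (Gamma y)) (x + 1) := by
  refine le_trans (le_of_eq ?_) (ConvexOn.slope_le_deriv convexOn_log_Gamma hx
    (by positivity : 0 < x + 1) (by linarith) (differentiableAt_log_Gamma (by positivity)))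
  rw [slope_def_field]
  simp [log_Gamma_add_one hx]

lemma tendsto_deriv_log_Gamma_add_natCast_sub_log {x : ℝ} (hx : 0 < x) :
    Tendsto (fun n : ℕ => deriv (fun y => log (Gamma y)) (x + n) - log n) atTop (𝓝 0) := by
  refine tendsto_of_tendsto_of_tendsto_of_le_of_le'
    ((tendsto_log_comp_add_sub_log (x - 1)).comp tendsto_natCast_atTop_atTop)
    ((tendsto_log_comp_add_sub_log x).comp tendsto_natCast_atTop_atTop) ?_ ?_
  · filter_upwards [eventually_ge_atTop 1] with n hn
    have hn' : (1 : ℝ) ≤ n := by exact_mod_cast hn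
    have := log_le_deriv_log_Gamma_add_one (x := n + (x - 1)) (by linarith)
    rw [show (n : ℝ) + (x - 1) + 1 = x + n by ring] at this
    simpa using this
  · filter_upwards with n
    simpa [add_comm] using deriv_log_Gamma_le_log (x := x + n) (by positivity)

lemma hasSum_deriv_log_Gamma_sub {a x : ℝ} (ha : 0 < a) (hax : a ≤ x) :
    HasSum (fun n : ℕ => 1 / (a + n) - 1 / (x + n))
      (deriv (fun y => log (Gamma y)) x - deriv (fun y => log (Gamma y)) a) := by
  have hx := ha.trans_le hax
  rw [hasSum_iff_tendsto_nat_of_nonneg]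
  · have := ((tendsto_deriv_log_Gamma_add_natCast_sub_log ha).sub
      (tendsto_deriv_log_Gamma_add_natCast_sub_log hx)).add_const
      (deriv (fun y => log (Gamma y)) x - deriv (fun y => log (Gamma y)) a)
    rw [sub_zero, zero_add] at this
    refine this.congr fun n => ?_
    rw [deriv_log_Gamma_add_natCast ha, deriv_log_Gamma_add_natCast hx, Finset.sum_sub_distrib]
    ring
  · intro n
    have : 1 / (x + n) ≤ 1 / (a + n) := by gcongr
    linarith

lemma summable_one_div_add_natCast_sq {x : ℝ} (hx : 0 < x) :
    Summable fun n : ℕ => 1 / (x + n) ^ 2 := by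
  refine ((summable_one_div_nat_add_rpow x 2).2 one_lt_two).congr fun n => ?_
  rw [abs_of_pos (by positivity), rpow_two, add_comm]

lemma iteratedDeriv_two_log_Gamma {x : ℝ} (hx : 0 < x) :
    iteratedDeriv 2 (fun y => log (Gamma y)) x = ∑' n : ℕ, 1 / (x + n) ^ 2 := by
  have ha : 0 < x / 2 := half_pos hx
  have hxa : x ∈ Ioi (x / 2) := half_lt_self hx
  have key : HasDerivAt (fun y => ∑' n : ℕ, (1 / (x / 2 + n) - 1 / (y + n)))
      (∑' n : ℕ, 1 / (x + n) ^ 2) x := by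
    refine hasDerivAt_tsum_of_isPreconnected (summable_one_div_add_natCast_sq ha) isOpen_Ioi
      isPreconnected_Ioi (g' := fun (n : ℕ) (y : ℝ) => 1 / (y + n) ^ 2) ?_ ?_ hxa
      (hasSum_deriv_log_Gamma_sub ha (le_of_lt hxa)).summable hxa
    · intro n y hy
      have hy0 : 0 < y := ha.trans hy
      have := (((hasDerivAt_id y).add_const (n : ℝ)).inv (by simp; positivity)).const_sub
        (1 / (x / 2 + n))
      simpa [neg_div] using this
    · intro n y hy
      have hy' : x / 2 < y := hy
      have hy0 : 0 < y := ha.trans hy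
      rw [norm_of_nonneg (by positivity)]
      gcongr
  rw [iteratedDeriv_succ, iteratedDeriv_one]
  refine ((key.add_const (deriv (fun y => log (Gamma y)) (x / 2))).congr_of_eventuallyEq ?_).deriv
  filter_upwards [Ioi_mem_nhds hxa] with y hy
  rw [(hasSum_deriv_log_Gamma_sub ha (le_of_lt hy)).tsum_eq]
  ring

lemma integral_mul_exp_neg_mul_Ioi {r : ℝ} (hr : 0 < r) :
    ∫ t in Ioi (0 : ℝ), t * exp (-(r * t)) = 1 / r ^ 2 := by
  have := integral_rpow_mul_exp_neg_mul_Ioi two_pos hr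
  norm_num at this
  simpa using this

lemma integrableOn_mul_exp_neg_mul_Ioi {r : ℝ} (hr : 0 < r) :
    IntegrableOn (fun t => t * exp (-(r * t))) (Ioi 0) :=
  .of_integral_ne_zero (by rw [integral_mul_exp_neg_mul_Ioi hr]; positivity)

lemma tsum_mul_exp_neg_add_natCast_mul (x : ℝ) {t : ℝ} (ht : 0 < t) :
    ∑' n : ℕ, t * exp (-((x + n) * t)) = t * exp t / (exp t - 1) * exp (-x * t) := by
  have h_eq (n : ℕ) : t * exp (-((x + n) * t)) = t * exp (-x * t) * exp (-t) ^ n := by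
    rw [← exp_nat_mul, mul_assoc, ← exp_add]
    ring_nf
  have h1 : 1 < exp t := one_lt_exp_iff.2 ht
  have h2 : exp t - 1 ≠ 0 := by linarith
  simp_rw [h_eq]
  rw [tsum_mul_left, tsum_geometric_of_lt_one (exp_pos _).le (exp_lt_one_iff.2 (by linarith)),
    exp_neg t]
  field_simp

lemma integral_mul_exp_div_exp_sub_one_mul_exp {x : ℝ} (hx : 0 < x) :
    ∫ t in Ioi (0 : ℝ), t * exp t / (exp t - 1) * exp (-x * t) = ∑' n : ℕ, 1 / (x + n) ^ 2 := by
  have hpos (n : ℕ) : 0 < x + n := by positivity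
  have hnorm (n : ℕ) : ∫ t in Ioi (0 : ℝ), ‖t * exp (-((x + n) * t))‖ = 1 / (x + n) ^ 2 := by
    rw [← integral_mul_exp_neg_mul_Ioi (hpos n)]
    refine setIntegral_congr_fun measurableSet_Ioi fun t ht => ?_
    have ht' : (0 : ℝ) < t := ht
    exact norm_of_nonneg (by positivity)
  have hsum := hasSum_integral_of_summable_integral_norm
    (μ := volume.restrict (Ioi (0 : ℝ))) (F := fun (n : ℕ) (t : ℝ) => t * exp (-((x + n) * t)))
    (fun n => integrableOn_mul_exp_neg_mul_Ioi (hpos n))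
    (by simpa only [hnorm] using summable_one_div_add_natCast_sq hx)
  simp only [integral_mul_exp_neg_mul_Ioi (hpos _)] at hsum
  rw [hsum.tsum_eq]
  exact setIntegral_congr_fun measurableSet_Ioi fun t ht =>
    (tsum_mul_exp_neg_add_natCast_mul x ht).symm

lemma integrableOn_one_add_mul_exp {x : ℝ} (hx : 0 < x) :
    IntegrableOn (fun t => (1 + t) * exp (-x * t)) (Ioi 0) := by
  refine ((integrableOn_exp_mul_Ioi (neg_neg_of_pos hx) 0).add
    (integrableOn_mul_exp_neg_mul_Ioi hx)).congr_fun (fun t _ => ?_) measurableSet_Ioi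
  simp only [Pi.add_apply, neg_mul]
  ring

lemma mul_exp_div_exp_sub_one_nonneg {t : ℝ} (ht : 0 < t) : 0 ≤ t * exp t / (exp t - 1) := by
  have := one_lt_exp_iff.2 ht
  exact div_nonneg (by positivity) (by linarith)

lemma mul_exp_div_exp_sub_one_le {t : ℝ} (ht : 0 < t) : t * exp t / (exp t - 1) ≤ 1 + t := by
  have := one_lt_exp_iff.2 ht
  rw [div_le_iff₀ (by linarith)]
  nlinarith [add_one_le_exp t]

lemma h_of_pos {t : ℝ} (ht : 0 < t) :
    h t = exp t * (exp t - 1 - t) / (exp t - 1) ^ 2 := if_neg ht.ne'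

lemma h_nonneg {t : ℝ} (ht : 0 < t) : 0 ≤ h t := by
  rw [h_of_pos ht]
  have := add_one_le_exp t
  exact div_nonneg (mul_nonneg (exp_pos t).le (by linarith)) (sq_nonneg _)

lemma h_le_one {t : ℝ} (ht : 0 < t) : h t ≤ 1 := by
  have h1 := one_lt_exp_iff.2 ht
  have h2 : exp t * (1 - t) ≤ 1 := by
    calc exp t * (1 - t) ≤ exp t * exp (-t) := by
          gcongr
          exact one_sub_le_exp_neg t
      _ = 1 := by rw [← exp_add, add_neg_cancel, exp_zero]
  rw [h_of_pos ht, div_le_one (pow_pos (by linarith) 2)]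
  nlinarith

lemma measurable_h : Measurable h := by
  unfold h
  exact Measurable.ite (measurableSet_singleton 0) measurable_const (by fun_prop)

lemma hasDerivAt_mul_exp_div_exp_sub_one {t : ℝ} (ht : 0 < t) :
    HasDerivAt (fun s => s * exp s / (exp s - 1)) (h t) t := by
  have h1 : exp t - 1 ≠ 0 := by linarith [one_lt_exp_iff.2 ht]
  refine (((hasDerivAt_id t).mul (hasDerivAt_exp t)).div
    ((hasDerivAt_exp t).sub_const 1) h1).congr_deriv ?_
  rw [h_of_pos ht]
  simp only [id, Pi.mul_apply]
  congr 1
  ring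

lemma tendsto_mul_exp_div_exp_sub_one :
    Tendsto (fun t => t * exp t / (exp t - 1)) (𝓝[>] 0) (𝓝 1) := by
  refine tendsto_of_tendsto_of_tendsto_of_le_of_le' (g := fun _ => 1) (h := fun t => 1 + t)
    tendsto_const_nhds ?_ ?_ ?_
  · have : ContinuousAt (fun t : ℝ => 1 + t) 0 := by fun_prop
    simpa using this.tendsto.mono_left nhdsWithin_le_nhds
  · filter_upwards [self_mem_nhdsWithin] with t ht
    have h1 := one_lt_exp_iff.2 (show 0 < t from ht)
    rw [le_div_iff₀ (by linarith)]
    have h2 : exp t * (1 - t) ≤ exp t * exp (-t) := by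
      gcongr
      exact one_sub_le_exp_neg t
    rw [← exp_add, add_neg_cancel, exp_zero] at h2
    linarith
  · filter_upwards [self_mem_nhdsWithin] with t ht using mul_exp_div_exp_sub_one_le ht

lemma tendsto_mul_exp_div_exp_sub_one_mul_exp {x : ℝ} (hx : 0 < x) :
    Tendsto (fun t => t * exp t / (exp t - 1) * exp (-x * t)) atTop (𝓝 0) := by
  have h0 := tendsto_rpow_mul_exp_neg_mul_atTop_nhds_zero 0 x hx
  have h1 := tendsto_rpow_mul_exp_neg_mul_atTop_nhds_zero 1 x hx
  refine tendsto_of_tendsto_of_tendsto_of_le_of_le' tendsto_const_nhds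
    (by simpa using h0.add h1) ?_ ?_
  · filter_upwards [eventually_gt_atTop 0] with t ht
    exact mul_nonneg (mul_exp_div_exp_sub_one_nonneg ht) (exp_pos _).le
  · filter_upwards [eventually_gt_atTop 0] with t ht
    have := mul_le_mul_of_nonneg_right (mul_exp_div_exp_sub_one_le ht) (exp_pos (-x * t)).le
    simpa [add_mul] using this

lemma integrableOn_h_mul_exp {x : ℝ} (hx : 0 < x) :
    IntegrableOn (fun t => h t * exp (-x * t)) (Ioi 0) := by
  refine (integrableOn_exp_mul_Ioi (neg_neg_of_pos hx) 0).mono'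
    (measurable_h.mul (by fun_prop)).aestronglyMeasurable ?_
  filter_upwards [ae_restrict_mem measurableSet_Ioi] with t ht
  rw [norm_of_nonneg (mul_nonneg (h_nonneg ht) (exp_pos _).le)]
  exact mul_le_of_le_one_left (exp_pos _).le (h_le_one ht)

lemma integrableOn_mul_exp_div_exp_sub_one_mul_exp {x : ℝ} (hx : 0 < x) :
    IntegrableOn (fun t => t * exp t / (exp t - 1) * exp (-x * t)) (Ioi 0) := by
  refine (integrableOn_one_add_mul_exp hx).mono'
    (Measurable.aestronglyMeasurable (by fun_prop)) ?_
  filter_upwards [ae_restrict_mem measurableSet_Ioi] with t ht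
  rw [norm_of_nonneg (mul_nonneg (mul_exp_div_exp_sub_one_nonneg ht) (exp_pos _).le)]
  exact mul_le_mul_of_nonneg_right (mul_exp_div_exp_sub_one_le ht) (exp_pos _).le

lemma integral_h_mul_exp {x : ℝ} (hx : 0 < x) :
    ∫ t in Ioi (0 : ℝ), h t * exp (-x * t) =
      x * (∫ t in Ioi (0 : ℝ), t * exp t / (exp t - 1) * exp (-x * t)) - 1 := by
  have hint := integrableOn_mul_exp_div_exp_sub_one_mul_exp hx
  have hv (t : ℝ) : HasDerivAt (fun s => exp (-x * s)) (exp (-x * t) * -x) t := by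
    simpa using ((hasDerivAt_id t).const_mul (-x)).exp
  have hzero : Tendsto (fun t => t * exp t / (exp t - 1) * exp (-x * t)) (𝓝[>] 0) (𝓝 1) := by
    have : ContinuousAt (fun t : ℝ => exp (-x * t)) 0 := by fun_prop
    simpa using tendsto_mul_exp_div_exp_sub_one.mul (this.tendsto.mono_left nhdsWithin_le_nhds)
  have key := integral_Ioi_mul_deriv_eq_deriv_mul
    (fun t ht => hasDerivAt_mul_exp_div_exp_sub_one ht) (fun t _ => hv t)
    (by simpa only [Pi.mul_def, mul_assoc] using! hint.mul_const (-x))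
    (integrableOn_h_mul_exp hx) hzero (tendsto_mul_exp_div_exp_sub_one_mul_exp hx)
  simp only [← mul_assoc] at key
  rw [integral_mul_const] at key
  linarith

end DigammaSeries

theorem Phi_integral_repr (x : ℝ) (hx : 0 < x) :
    Phi x = ∫ t in Set.Ioi (0:ℝ), h t * Real.exp (-x * t) := by
  rw [Phi, iteratedDeriv_two_log_Gamma hx, integral_h_mul_exp hx,
    integral_mul_exp_div_exp_sub_one_mul_exp hx]
end

section
/- For all nonnegative integers m and n, the function Y_{m,n}(x) = Φ^{(m+n+1)}(x) / (Φ^{(m)}(x) Φ^{(n)}(x)) tends to −(m+n+1)!/(m!·n!) as x → 0⁺ and tends to −2(m+n+1)!/(m!·n!) as x → ∞. -/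
open Filter

noncomputable def Y (m n : ℕ) (x : ℝ) : ℝ :=
  iteratedDeriv (m + n + 1) Phi x / (iteratedDeriv m Phi x * iteratedDeriv n Phi x)

open Topology Finset

/-- The Hurwitz-type series `∑ 1 / (x + n) ^ s` for real `x` and natural `s`. -/
noncomputable def hurwitzSum (s : ℕ) (x : ℝ) : ℝ := ∑' n : ℕ, 1 / (x + n) ^ s

lemma summable_hurwitzSum {s : ℕ} (hs : 2 ≤ s) {x : ℝ} (hx : 0 < x) :
    Summable fun n : ℕ => 1 / (x + n) ^ s := by
  refine ((Real.summable_one_div_nat_add_rpow x s).2 (by exact_mod_cast hs)).congr fun n => ?_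
  rw [abs_of_pos (by positivity), Real.rpow_natCast, add_comm]

lemma hasDerivAt_hurwitzSum {s : ℕ} (hs : 2 ≤ s) {x : ℝ} (hx : 0 < x) :
    HasDerivAt (hurwitzSum s) (-(s * hurwitzSum (s + 1) x)) x := by
  have hderiv : ∀ (n : ℕ) (y : ℝ), y ∈ Set.Ioi (x / 2) →
      HasDerivAt (fun y : ℝ => 1 / (y + n) ^ s) (-s * (1 / (y + n) ^ (s + 1))) y := by
    intro n y hy
    have hy0 : 0 < y := (half_pos hx).trans hy
    have hne : y + n ≠ 0 := by positivity
    have h := (((hasDerivAt_id y).add_const (n : ℝ)).pow s).inv (pow_ne_zero s hne)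
    simp only [one_div]
    refine h.congr_deriv ?_
    obtain ⟨r, rfl⟩ := Nat.exists_eq_add_of_le' (show 1 ≤ s by omega)
    simp only [id, Pi.pow_apply, Nat.add_sub_cancel]
    field_simp
    ring
  have hbound : ∀ (n : ℕ) (y : ℝ), y ∈ Set.Ioi (x / 2) →
      ‖-s * (1 / (y + n) ^ (s + 1))‖ ≤ s * (1 / (x / 2 + n) ^ (s + 1)) := by
    intro n y hy
    have hy0 : 0 < y := (half_pos hx).trans hy
    rw [norm_mul, norm_neg, Real.norm_natCast, Real.norm_of_nonneg (by positivity)]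
    have : x / 2 ≤ y := le_of_lt hy
    gcongr
  have h := hasDerivAt_tsum_of_isPreconnected
    ((summable_hurwitzSum (show 2 ≤ s + 1 by omega) (half_pos hx)).mul_left (s : ℝ))
    isOpen_Ioi isPreconnected_Ioi hderiv hbound (half_lt_self hx) (summable_hurwitzSum hs hx)
    (half_lt_self hx)
  rw [tsum_mul_left, neg_mul] at h
  exact h

lemma hurwitzSum_eq_add {s : ℕ} (hs : 2 ≤ s) {x : ℝ} (hx : 0 < x) :
    hurwitzSum s x = 1 / x ^ s + hurwitzSum s (x + 1) := by
  unfold hurwitzSum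
  rw [(summable_hurwitzSum hs hx).tsum_eq_zero_add]
  simp only [Nat.cast_zero, Nat.cast_succ, add_zero, add_assoc, add_comm (1 : ℝ)]

lemma tendsto_pow_mul_hurwitzSum_zero {s : ℕ} (hs : 2 ≤ s) :
    Tendsto (fun x => x ^ s * hurwitzSum s x) (𝓝[>] 0) (𝓝 1) := by
  have hc : ContinuousAt (fun x : ℝ => x ^ s * hurwitzSum s (x + 1)) 0 := by
    have h : ContinuousAt (hurwitzSum s) (0 + 1) :=
      (hasDerivAt_hurwitzSum hs (by norm_num)).continuousAt
    exact (continuousAt_id.pow s).mul (h.comp (f := fun x : ℝ => x + 1) (by fun_prop))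
  have h := (hc.tendsto.mono_left (nhdsWithin_le_nhds (s := Set.Ioi 0))).const_add 1
  rw [zero_pow (by omega), zero_mul, add_zero] at h
  refine h.congr' ?_
  filter_upwards [self_mem_nhdsWithin] with x hx
  have hx : 0 < x := hx
  rw [hurwitzSum_eq_add hs hx, mul_add, mul_one_div_cancel (by positivity)]

lemma two_mul_sum_pow_mul_pow (a b : ℝ) (k : ℕ) :
    2 * ∑ i ∈ range (k + 1), a ^ i * b ^ (k - i) =
      ∑ i ∈ range (k + 1), (a ^ i * b ^ (k - i) + a ^ (k - i) * b ^ i) := by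
  rw [two_mul, sum_add_distrib]
  congr 1
  rw [← sum_range_reflect]
  refine sum_congr rfl fun i hi => ?_
  have := mem_range.1 hi
  rw [show k + 1 - 1 - i = k - i by omega, show k - (k - i) = i by omega]

lemma mul_sum_pow_mul_pow_le {a b : ℝ} (ha : 0 ≤ a) (hb : 0 ≤ b) (k : ℕ) :
    a * b * ∑ i ∈ range (k + 1), a ^ i * b ^ (k - i) ≤
      (k + 1) * ((a ^ (k + 2) + b ^ (k + 2)) / 2) := by
  have key : ∀ i ∈ range (k + 1), a * b * (a ^ i * b ^ (k - i) + a ^ (k - i) * b ^ i) ≤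
      a ^ (k + 2) + b ^ (k + 2) := by
    intro i hi
    obtain ⟨j, rfl⟩ := Nat.exists_eq_add_of_le (Nat.lt_succ_iff.1 (mem_range.1 hi))
    rw [Nat.add_sub_cancel_left]
    have h : 0 ≤ (a ^ (i + 1) - b ^ (i + 1)) * (a ^ (j + 1) - b ^ (j + 1)) := by
      rcases le_total a b with h | h
      · exact mul_nonneg_of_nonpos_of_nonpos (sub_nonpos.2 (by gcongr)) (sub_nonpos.2 (by gcongr))
      · exact mul_nonneg (sub_nonneg.2 (by gcongr)) (sub_nonneg.2 (by gcongr))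
    ring_nf at h ⊢
    linarith
  have h := sum_le_card_nsmul _ _ _ key
  rw [← mul_sum, ← two_mul_sum_pow_mul_pow, card_range, nsmul_eq_mul] at h
  push_cast at h
  linarith

lemma le_mul_sum_pow_mul_pow {a b c : ℝ} (ha : 0 ≤ a) (hb : 0 ≤ b) (hc : 0 ≤ c)
    (h : c ^ 2 ≤ a * b) (k : ℕ) :
    (k + 1) * c ^ (k + 2) ≤ a * b * ∑ i ∈ range (k + 1), a ^ i * b ^ (k - i) := by
  have key : ∀ i ∈ range (k + 1), 2 * c ^ (k + 2) ≤
      a * b * (a ^ i * b ^ (k - i) + a ^ (k - i) * b ^ i) := by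
    intro i hi
    obtain ⟨j, rfl⟩ := Nat.exists_eq_add_of_le (Nat.lt_succ_iff.1 (mem_range.1 hi))
    rw [Nat.add_sub_cancel_left]
    refine (sq_le_sq₀ (by positivity) (by positivity)).1 ?_
    have h1 : (c ^ 2) ^ (i + j + 2) ≤ (a * b) ^ (i + j + 2) := by gcongr
    have h2 := sq_nonneg (a * b * (a ^ i * b ^ j - a ^ j * b ^ i))
    ring_nf at h1 h2 ⊢
    linarith
  have h := card_nsmul_le_sum _ _ _ key
  rw [← mul_sum, ← two_mul_sum_pow_mul_pow, card_range, nsmul_eq_mul] at h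
  push_cast at h
  linarith

lemma inv_pow_sub_inv_pow_add_one {x : ℝ} (hx : 0 < x) (k : ℕ) :
    x⁻¹ ^ (k + 1) - (x + 1)⁻¹ ^ (k + 1) =
      x⁻¹ * (x + 1)⁻¹ * ∑ i ∈ range (k + 1), x⁻¹ ^ i * (x + 1)⁻¹ ^ (k - i) := by
  have h := geom_sum₂_mul x⁻¹ (x + 1)⁻¹ (k + 1)
  rw [← h, mul_comm, Nat.add_sub_cancel]
  congr 1
  field_simp
  ring

lemma tendsto_inv_pow_add_natCast (x : ℝ) {k : ℕ} (hk : k ≠ 0) :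
    Tendsto (fun n : ℕ => (x + n)⁻¹ ^ k) atTop (𝓝 0) := by
  have h : Tendsto (fun n : ℕ => (x + n)⁻¹) atTop (𝓝 0) :=
    (tendsto_atTop_add_const_left _ x tendsto_natCast_atTop_atTop).inv_tendsto_atTop
  simpa [hk] using h.pow k

lemma hurwitzSum_le {x : ℝ} (hx : 1 / 2 < x) (k : ℕ) :
    (k + 1) * hurwitzSum (k + 2) x ≤ (x - 1 / 2)⁻¹ ^ (k + 1) := by
  have hx0 : 0 < x := by linarith
  rw [hurwitzSum, ← tsum_mul_left]
  have hstep : ∀ n : ℕ, (k + 1) * (1 / (x + n) ^ (k + 2)) ≤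
      (x - 1 / 2 + n)⁻¹ ^ (k + 1) - (x - 1 / 2 + (n + 1 : ℕ))⁻¹ ^ (k + 1) := by
    intro n
    have hn : (0 : ℝ) ≤ n := n.cast_nonneg
    have hp : 0 < x - 1 / 2 + n := by linarith
    rw [show x - 1 / 2 + ((n + 1 : ℕ) : ℝ) = x - 1 / 2 + n + 1 by push_cast; ring,
      inv_pow_sub_inv_pow_add_one hp, one_div, ← inv_pow]
    refine le_mul_sum_pow_mul_pow (by positivity) (by positivity) (by positivity) ?_ k
    rw [← mul_inv, inv_pow]
    gcongr
    nlinarith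
  refine Real.tsum_le_of_sum_range_le (fun n => by positivity) fun n => ?_
  refine (sum_le_sum fun i _ => hstep i).trans ?_
  rw [sum_range_sub' (fun n : ℕ => (x - 1 / 2 + n)⁻¹ ^ (k + 1))]
  have hn : (0 : ℝ) ≤ n := n.cast_nonneg
  have hp : 0 < x - 1 / 2 + n := by linarith
  have : 0 ≤ (x - 1 / 2 + n)⁻¹ ^ (k + 1) := by positivity
  simp only [Nat.cast_zero, add_zero]
  linarith

lemma le_hurwitzSum {x : ℝ} (hx : 0 < x) (k : ℕ) :
    x⁻¹ ^ (k + 1) + (k + 1) / 2 * x⁻¹ ^ (k + 2) ≤ (k + 1) * hurwitzSum (k + 2) x := by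
  have hstep : ∀ n : ℕ, (x + n)⁻¹ ^ (k + 1) - (x + (n + 1 : ℕ))⁻¹ ^ (k + 1) +
      ((k + 1) / 2 * (x + n)⁻¹ ^ (k + 2) - (k + 1) / 2 * (x + (n + 1 : ℕ))⁻¹ ^ (k + 2)) ≤
      (k + 1) * (1 / (x + n) ^ (k + 2)) := by
    intro n
    rw [show x + ((n + 1 : ℕ) : ℝ) = x + n + 1 by push_cast; ring,
      inv_pow_sub_inv_pow_add_one (by positivity), one_div, ← inv_pow]
    have := mul_sum_pow_mul_pow_le (a := (x + n)⁻¹) (b := (x + n + 1)⁻¹) (by positivity)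
      (by positivity) k
    linarith
  have hs := ((summable_hurwitzSum (show 2 ≤ k + 2 by omega) hx).mul_left
    ((k : ℝ) + 1)).hasSum.tendsto_sum_nat
  rw [tsum_mul_left] at hs
  have hl := ((tendsto_inv_pow_add_natCast x k.succ_ne_zero).const_sub (x⁻¹ ^ (k + 1))).add
    (((tendsto_inv_pow_add_natCast x (k + 1).succ_ne_zero).const_mul (((k : ℝ) + 1) / 2)).const_sub
      (((k : ℝ) + 1) / 2 * x⁻¹ ^ (k + 2)))
  simp only [sub_zero, mul_zero] at hl
  refine le_of_tendsto_of_tendsto' hl hs fun n => ?_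
  refine le_trans (le_of_eq ?_) (sum_le_sum fun i _ => hstep i)
  rw [sum_add_distrib, sum_range_sub' (fun n : ℕ => (x + n)⁻¹ ^ (k + 1)),
    sum_range_sub' (fun n : ℕ => ((k : ℝ) + 1) / 2 * (x + n)⁻¹ ^ (k + 2))]
  simp

lemma tendsto_mul_one_sub_inv_pow (k : ℕ) :
    Tendsto (fun x : ℝ => x * ((1 - x⁻¹ / 2)⁻¹ ^ (k + 1) - 1)) atTop (𝓝 ((k + 1) / 2)) := by
  have hd : HasDerivAt (fun u : ℝ => (1 - u / 2)⁻¹ ^ (k + 1)) ((k + 1) / 2) 0 := by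
    have h := ((((hasDerivAt_id (0 : ℝ)).div_const 2).const_sub 1).fun_inv (by simp)).fun_pow (k + 1)
    refine h.congr_deriv ?_
    simp
    ring
  have h := (hasDerivAt_iff_tendsto_slope_zero.1 hd).comp
    (tendsto_inv_atTop_nhdsGT_zero.mono_right
      (nhdsWithin_mono _ fun x (hx : (0 : ℝ) < x) => hx.ne'))
  refine h.congr fun x => ?_
  simp

lemma tendsto_pow_mul_hurwitzSum_atTop (k : ℕ) :
    Tendsto (fun x => x ^ (k + 2) * hurwitzSum (k + 2) x - x / (k + 1)) atTop (𝓝 (1 / 2)) := by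
  have hup := (tendsto_mul_one_sub_inv_pow k).div_const ((k : ℝ) + 1)
  rw [div_right_comm, div_self (by positivity)] at hup
  refine tendsto_of_tendsto_of_tendsto_of_le_of_le' tendsto_const_nhds hup ?_ ?_
  · filter_upwards [eventually_gt_atTop 0] with x hx
    have h := mul_le_mul_of_nonneg_left (le_hurwitzSum hx k) (show 0 ≤ x ^ (k + 2) by positivity)
    have e : x ^ (k + 2) * (x⁻¹ ^ (k + 1) + (k + 1) / 2 * x⁻¹ ^ (k + 2)) = x + (k + 1) / 2 := by
      simp only [inv_pow]
      field_simp
      ring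
    rw [e] at h
    rw [le_sub_iff_add_le, ← mul_le_mul_iff_right₀ (show (0 : ℝ) < k + 1 by positivity)]
    refine le_trans (le_of_eq ?_) (h.trans (le_of_eq ?_))
    · field_simp
      ring
    · ring
  · filter_upwards [eventually_gt_atTop 1] with x hx
    have hx0 : 0 < x := by linarith
    have h := mul_le_mul_of_nonneg_left (hurwitzSum_le (show 1 / 2 < x by linarith) k)
      (show 0 ≤ x ^ (k + 2) by positivity)
    have e : x ^ (k + 2) * (x - 1 / 2)⁻¹ ^ (k + 1) = x * (1 - x⁻¹ / 2)⁻¹ ^ (k + 1) := by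
      rw [pow_succ' x (k + 1), mul_assoc, ← mul_pow]
      congr 2
      rw [← div_eq_mul_inv, show 1 - x⁻¹ / 2 = (x - 1 / 2) / x by field_simp, inv_div]
    rw [e] at h
    rw [← mul_le_mul_iff_right₀ (show (0 : ℝ) < k + 1 by positivity)]
    refine le_trans (le_of_eq ?_) ((sub_le_sub_right h x).trans (le_of_eq ?_))
    · field_simp
    · field_simp

/-- The increments in `n` of `Real.BohrMollerup.logGammaSeq x n`. -/
noncomputable def logGammaTerm (n : ℕ) (x : ℝ) : ℝ :=
  x * (Real.log (n + 1) - Real.log n) + Real.log (n + 1) - Real.log (x + (n + 1))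

/-- The derivative of `logGammaTerm n`. -/
noncomputable def logGammaTermDeriv (n : ℕ) (x : ℝ) : ℝ :=
  Real.log (n + 1) - Real.log n - 1 / (x + (n + 1))

lemma logGammaSeq_eq_sum (x : ℝ) (N : ℕ) :
    Real.BohrMollerup.logGammaSeq x N = -Real.log x + ∑ n ∈ range N, logGammaTerm n x := by
  induction N with
  | zero => simp [Real.BohrMollerup.logGammaSeq]
  | succ N ih =>
    rw [sum_range_succ, ← add_assoc, ← ih, Real.BohrMollerup.logGammaSeq,
      Real.BohrMollerup.logGammaSeq, sum_range_succ _ (N + 1), Nat.factorial_succ, Nat.cast_mul,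
      Real.log_mul (by positivity) (by positivity), logGammaTerm]
    push_cast
    ring

lemma hasDerivAt_logGammaTerm (n : ℕ) {x : ℝ} (hx : -(1 / 2) < x) :
    HasDerivAt (logGammaTerm n) (logGammaTermDeriv n x) x := by
  have hn : (0 : ℝ) ≤ n := n.cast_nonneg
  have hne : x + ((n : ℝ) + 1) ≠ 0 := by linarith
  have h := (((hasDerivAt_id x).mul_const (Real.log (n + 1) - Real.log n)).add_const
    (Real.log (n + 1))).sub (((hasDerivAt_id x).add_const ((n : ℝ) + 1)).log hne)
  exact h.congr_deriv (by simp [logGammaTermDeriv])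

lemma hasDerivAt_logGammaTermDeriv (n : ℕ) {x : ℝ} (hx : 0 < x) :
    HasDerivAt (logGammaTermDeriv n) (1 / (x + 1 + n) ^ 2) x := by
  have hne : x + ((n : ℝ) + 1) ≠ 0 := by positivity
  have h := (((hasDerivAt_id x).add_const ((n : ℝ) + 1)).fun_inv hne).const_sub
    (Real.log (n + 1) - Real.log n)
  simp only [← one_div] at h
  refine h.congr_deriv ?_
  simp only [id]
  rw [add_assoc x 1, add_comm (1 : ℝ)]
  ring

lemma abs_logGammaTermDeriv_le (n : ℕ) {x R : ℝ} (hx : -(1 / 2) < x) (hR : x < R) :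
    |logGammaTermDeriv n x| ≤ 4 * (R + 1) * (1 / (1 + n) ^ 2) := by
  unfold logGammaTermDeriv
  rcases Nat.eq_zero_or_pos n with rfl | hn
  · simp only [Nat.cast_zero, zero_add, Real.log_one, Real.log_zero, sub_zero, zero_sub, abs_neg]
    rw [abs_of_pos (by apply one_div_pos.2; linarith), div_le_iff₀ (by linarith)]
    nlinarith
  have hn1 : (1 : ℝ) ≤ n := by exact_mod_cast hn
  have hn0 : (0 : ℝ) < n := by linarith
  have hp : 0 < x + ((n : ℝ) + 1) := by linarith
  have hlog : Real.log (n + 1) - Real.log n = Real.log ((n + 1) / n) :=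
    (Real.log_div (by positivity) (by positivity)).symm
  have hu := Real.log_le_sub_one_of_pos (show 0 < ((n : ℝ) + 1) / n by positivity)
  have hl := Real.one_sub_inv_le_log_of_pos (show 0 < ((n : ℝ) + 1) / n by positivity)
  have eu : ((n : ℝ) + 1) / n - 1 = 1 / n := by field_simp; ring
  have el : 1 - (((n : ℝ) + 1) / n)⁻¹ = 1 / (n + 1) := by field_simp; ring
  rw [eu] at hu
  rw [el] at hl
  rw [hlog, abs_le]
  constructor
  · have : 1 / (x + ((n : ℝ) + 1)) - 1 / (n + 1) ≤ 4 * (R + 1) * (1 / (1 + n) ^ 2) := by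
      rw [div_sub_div _ _ hp.ne' (by positivity), mul_one_div,
        div_le_div_iff₀ (by positivity) (by positivity)]
      have h1 : (1 * ((n : ℝ) + 1) - (x + (n + 1)) * 1) ≤ 1 / 2 := by linarith
      have h2 : (1 + (n : ℝ)) ≤ 2 * (x + (n + 1)) := by linarith
      calc _ ≤ 1 / 2 * (1 + (n : ℝ)) ^ 2 := by gcongr
        _ ≤ 2 * ((x + (n + 1)) * (n + 1)) := by nlinarith
        _ ≤ _ := by gcongr; linarith
    linarith
  · have : 1 / (n : ℝ) - 1 / (x + ((n : ℝ) + 1)) ≤ 4 * (R + 1) * (1 / (1 + n) ^ 2) := by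
      rw [div_sub_div _ _ hn0.ne' hp.ne', mul_one_div,
        div_le_div_iff₀ (by positivity) (by positivity)]
      have h1 : (1 * (x + ((n : ℝ) + 1)) - n * 1) ≤ R + 1 := by linarith
      have h2 : (1 + (n : ℝ)) ^ 2 ≤ 4 * (n * (x + (n + 1))) := by nlinarith
      calc _ ≤ (R + 1) * (1 + (n : ℝ)) ^ 2 := by gcongr
        _ ≤ (R + 1) * (4 * (n * (x + (n + 1)))) := by gcongr; linarith
        _ = _ := by ring
    linarith

lemma summable_logGammaTerm_bound (R : ℝ) :
    Summable fun n : ℕ => 4 * (R + 1) * (1 / (1 + (n : ℝ)) ^ 2) :=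
  (summable_hurwitzSum le_rfl one_pos).mul_left _

lemma logGammaTerm_zero (n : ℕ) : logGammaTerm n 0 = 0 := by
  simp [logGammaTerm]

lemma hasDerivAt_tsum_logGammaTerm {x : ℝ} (hx : 0 < x) :
    HasDerivAt (fun y => ∑' n, logGammaTerm n y) (∑' n, logGammaTermDeriv n x) x :=
  hasDerivAt_tsum_of_isPreconnected (t := Set.Ioo (-(1 / 2)) (x + 1)) (y₀ := 0)
    (summable_logGammaTerm_bound (x + 1)) isOpen_Ioo isPreconnected_Ioo
    (fun n _ hy => hasDerivAt_logGammaTerm n hy.1)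
    (fun n _ hy => abs_logGammaTermDeriv_le n hy.1 hy.2)
    ⟨by norm_num, by linarith⟩ (by simp [logGammaTerm_zero, summable_zero])
    ⟨by linarith, by linarith⟩

lemma summable_logGammaTermDeriv {x : ℝ} (hx : 0 < x) :
    Summable fun n => logGammaTermDeriv n x :=
  .of_norm_bounded (summable_logGammaTerm_bound (x + 1)) fun n =>
    abs_logGammaTermDeriv_le n (by linarith) (by linarith)

lemma summable_logGammaTerm {x : ℝ} (hx : 0 < x) : Summable fun n => logGammaTerm n x :=
  summable_of_summable_hasDerivAt_of_isPreconnected (t := Set.Ioo (-(1 / 2)) (x + 1)) (y₀ := 0)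
    (summable_logGammaTerm_bound (x + 1)) isOpen_Ioo isPreconnected_Ioo
    (fun n _ hy => hasDerivAt_logGammaTerm n hy.1)
    (fun n _ hy => abs_logGammaTermDeriv_le n hy.1 hy.2)
    ⟨by norm_num, by linarith⟩ (by simp [logGammaTerm_zero, summable_zero])
    ⟨by linarith, by linarith⟩

lemma hasDerivAt_tsum_logGammaTermDeriv {x : ℝ} (hx : 0 < x) :
    HasDerivAt (fun y => ∑' n, logGammaTermDeriv n y) (hurwitzSum 2 (x + 1)) x := by
  refine hasDerivAt_tsum_of_isPreconnected (t := Set.Ioi 0) (y₀ := x)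
    (summable_hurwitzSum le_rfl one_pos) isOpen_Ioi isPreconnected_Ioi
    (fun n _ hy => hasDerivAt_logGammaTermDeriv n hy) (fun n y hy => ?_)
    hx (summable_logGammaTermDeriv hx) hx
  have hy : 0 < y := hy
  rw [Real.norm_of_nonneg (by positivity)]
  gcongr
  linarith

lemma log_Gamma_eq_tsum {x : ℝ} (hx : 0 < x) :
    Real.log (Real.Gamma x) = -Real.log x + ∑' n, logGammaTerm n x := by
  refine tendsto_nhds_unique (Real.BohrMollerup.tendsto_log_gamma hx) ?_
  simp_rw [funext (logGammaSeq_eq_sum x)]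
  exact (summable_logGammaTerm hx).hasSum.tendsto_sum_nat.const_add _

lemma deriv_log_Gamma {x : ℝ} (hx : 0 < x) :
    deriv (fun y => Real.log (Real.Gamma y)) x = -x⁻¹ + ∑' n, logGammaTermDeriv n x := by
  have h : (fun y => Real.log (Real.Gamma y)) =ᶠ[𝓝 x]
      fun y => -Real.log y + ∑' n, logGammaTerm n y :=
    (eventually_gt_nhds hx).mono fun y hy => log_Gamma_eq_tsum hy
  rw [h.deriv_eq]
  exact ((Real.hasDerivAt_log hx.ne').neg.add (hasDerivAt_tsum_logGammaTerm hx)).deriv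

/-- The series expansion of the trigamma function. -/
lemma iteratedDeriv_two_log_Gamma_s11 {x : ℝ} (hx : 0 < x) :
    iteratedDeriv 2 (fun y => Real.log (Real.Gamma y)) x = hurwitzSum 2 x := by
  rw [iteratedDeriv_succ, iteratedDeriv_one]
  have h : deriv (fun y => Real.log (Real.Gamma y)) =ᶠ[𝓝 x]
      fun y => -y⁻¹ + ∑' n, logGammaTermDeriv n y :=
    (eventually_gt_nhds hx).mono fun y hy => deriv_log_Gamma hy
  rw [h.deriv_eq, hurwitzSum_eq_add le_rfl hx]
  refine ((hasDerivAt_inv hx.ne').neg.add (hasDerivAt_tsum_logGammaTermDeriv hx)).deriv.trans ?_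
  simp

lemma Phi_eq {x : ℝ} (hx : 0 < x) : Phi x = x * hurwitzSum 2 x - 1 := by
  rw [Phi, iteratedDeriv_two_log_Gamma_s11 hx]

lemma iteratedDeriv_succ_Phi (k : ℕ) {x : ℝ} (hx : 0 < x) :
    iteratedDeriv (k + 1) Phi x = (-1) ^ (k + 1) * (((k + 2).factorial : ℝ) *
      (x * hurwitzSum (k + 3) x) - (k + 1) * (k + 1).factorial * hurwitzSum (k + 2) x) := by
  induction k generalizing x with
  | zero =>
    have h : Phi =ᶠ[𝓝 x] fun y => y * hurwitzSum 2 y - 1 :=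
      (eventually_gt_nhds hx).mono fun y hy => Phi_eq hy
    rw [iteratedDeriv_one, h.deriv_eq]
    refine (((hasDerivAt_id x).fun_mul (hasDerivAt_hurwitzSum le_rfl hx)).sub_const 1).deriv.trans ?_
    simp [Nat.factorial]
    ring
  | succ k ih =>
    rw [iteratedDeriv_succ,
      EventuallyEq.deriv_eq ((eventually_gt_nhds hx).mono fun y hy => ih hy)]
    refine (((((hasDerivAt_id x).fun_mul (hasDerivAt_hurwitzSum (by omega) hx)).const_mul _).fun_sub
      ((hasDerivAt_hurwitzSum (by omega) hx).const_mul _)).const_mul _).deriv.trans ?_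
    rw [Nat.factorial_succ (k + 2), Nat.factorial_succ (k + 1)]
    push_cast
    simp only [id]
    ring

lemma tendsto_pow_mul_iteratedDeriv_Phi_zero (k : ℕ) :
    Tendsto (fun x => x ^ (k + 1) * iteratedDeriv k Phi x) (𝓝[>] 0)
      (𝓝 ((-1) ^ k * k.factorial)) := by
  cases k with
  | zero =>
    have h := (tendsto_pow_mul_hurwitzSum_zero le_rfl).sub
      (tendsto_id.mono_left (nhdsWithin_le_nhds (a := (0 : ℝ)) (s := Set.Ioi 0)))
    simp only [sub_zero] at h
    simp only [pow_zero, Nat.factorial_zero, Nat.cast_one, mul_one]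
    refine h.congr' ?_
    filter_upwards [self_mem_nhdsWithin] with x hx
    rw [iteratedDeriv_zero, Phi_eq hx, id]
    ring
  | succ k =>
    have h := (((tendsto_pow_mul_hurwitzSum_zero (show 2 ≤ k + 3 by omega)).const_mul
      ((k + 2).factorial : ℝ)).sub ((tendsto_pow_mul_hurwitzSum_zero
      (show 2 ≤ k + 2 by omega)).const_mul (((k : ℝ) + 1) * (k + 1).factorial))).const_mul
      ((-1) ^ (k + 1))
    convert h.congr' ?_ using 2
    · rw [Nat.factorial_succ (k + 1)]
      push_cast
      ring
    · filter_upwards [self_mem_nhdsWithin] with x hx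
      rw [iteratedDeriv_succ_Phi k hx]
      ring

lemma tendsto_pow_mul_iteratedDeriv_Phi_atTop (k : ℕ) :
    Tendsto (fun x => x ^ (k + 1) * iteratedDeriv k Phi x) atTop
      (𝓝 ((-1) ^ k * k.factorial / 2)) := by
  cases k with
  | zero =>
    have h := tendsto_pow_mul_hurwitzSum_atTop 0
    simp only [pow_zero, Nat.factorial_zero, Nat.cast_one, mul_one]
    refine h.congr' ?_
    filter_upwards [eventually_gt_atTop 0] with x hx
    rw [iteratedDeriv_zero, Phi_eq hx]
    push_cast
    ring
  | succ k =>
    have h := (((tendsto_pow_mul_hurwitzSum_atTop (k + 1)).const_mul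
      ((k + 2).factorial : ℝ)).sub ((tendsto_pow_mul_hurwitzSum_atTop k).const_mul
      (((k : ℝ) + 1) * (k + 1).factorial))).const_mul ((-1) ^ (k + 1))
    convert h.congr' ?_ using 2
    · rw [Nat.factorial_succ (k + 1)]
      push_cast
      ring
    · filter_upwards [eventually_gt_atTop 0] with x hx
      rw [iteratedDeriv_succ_Phi k hx, Nat.factorial_succ (k + 1)]
      push_cast
      field_simp
      ring

lemma tendsto_Y {l : Filter ℝ} {c : ℝ} (hc : c ≠ 0) (hl : ∀ᶠ x in l, 0 < x)
    (h : ∀ k : ℕ, Tendsto (fun x => x ^ (k + 1) * iteratedDeriv k Phi x) l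
      (𝓝 ((-1) ^ k * k.factorial / c))) (m n : ℕ) :
    Tendsto (Y m n) l
      (𝓝 (-(c * ((m + n + 1).factorial : ℝ) / (m.factorial * n.factorial)))) := by
  have key := (h (m + n + 1)).div ((h m).mul (h n)) (by positivity)
  convert key.congr' ?_ using 2
  · have h1 : ((-1 : ℝ) ^ m) ≠ 0 := by positivity
    have h2 : ((-1 : ℝ) ^ n) ≠ 0 := by positivity
    rw [pow_succ, pow_add]
    field_simp
  · filter_upwards [hl] with x hx
    rw [Y, Pi.div_apply, mul_mul_mul_comm, ← pow_add,
      show m + 1 + (n + 1) = m + n + 1 + 1 by ring, mul_div_mul_left _ _ (by positivity)]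

theorem Y_limits (m n : ℕ) :
    Tendsto (Y m n) (nhdsWithin 0 (Set.Ioi 0))
      (nhds (-((Nat.factorial (m + n + 1) : ℝ) / (Nat.factorial m * Nat.factorial n)))) ∧
    Tendsto (Y m n) atTop
      (nhds (-(2 * (Nat.factorial (m + n + 1) : ℝ) / (Nat.factorial m * Nat.factorial n)))) := by
  refine ⟨?_, tendsto_Y two_ne_zero (eventually_gt_atTop 0)
    tendsto_pow_mul_iteratedDeriv_Phi_atTop m n⟩
  have h := tendsto_Y one_ne_zero (l := 𝓝[>] 0) self_mem_nhdsWithin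
    (fun k => by simpa using tendsto_pow_mul_iteratedDeriv_Phi_zero k) m n
  rwa [one_mul] at h
end
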